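/- arXiv:0908.3618 — 2 statements merged into one kernel-verified Lean document; each statement's English description precedes it below -/
import Mathlib

section
/- For every smooth function f : ℝ³ → ℝ and every point (r,θ,z) with r > 0, the commutator identities [X₁,X₆]f = X₇f and [X₁,X₇]f = −X₆f hold at (r,θ,z). (Entries of the commutator Table 1 of Theorem 1.) -/
/-- Partial derivative with respect to the first argument (`r`). -/
noncomputable def p1 (f : ℝ → ℝ → ℝ → ℝ) (r θ z : ℝ) : ℝ :=
  deriv (fun s => f s θ z) r

/-- Partial derivative with respect to the second argument (`θ`). -/
noncomputable def p2 (f : ℝ → ℝ → ℝ → ℝ) (r θ z : ℝ) : ℝ :=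
  deriv (fun s => f r s z) θ

/-- Partial derivative with respect to the third argument (`z`). -/
noncomputable def p3 (f : ℝ → ℝ → ℝ → ℝ) (r θ z : ℝ) : ℝ :=
  deriv (fun s => f r θ s) z

/-- `X₁ f = f_θ`. -/
noncomputable def X1 (f : ℝ → ℝ → ℝ → ℝ) (r θ z : ℝ) : ℝ := p2 f r θ z

/-- `X₂ f = f_z`. -/
noncomputable def X2 (f : ℝ → ℝ → ℝ → ℝ) (r θ z : ℝ) : ℝ := p3 f r θ z

/-- `X₄ f = sin θ · f_r + (cos θ / r) · f_θ`. -/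
noncomputable def X4 (f : ℝ → ℝ → ℝ → ℝ) (r θ z : ℝ) : ℝ :=
  Real.sin θ * p1 f r θ z + (Real.cos θ / r) * p2 f r θ z

/-- `X₅ f = −cos θ · f_r + (sin θ / r) · f_θ`. -/
noncomputable def X5 (f : ℝ → ℝ → ℝ → ℝ) (r θ z : ℝ) : ℝ :=
  -Real.cos θ * p1 f r θ z + (Real.sin θ / r) * p2 f r θ z

/-- `X₆ f = −z cos θ · f_r + (z sin θ / r) · f_θ + r cos θ · f_z`. -/
noncomputable def X6 (f : ℝ → ℝ → ℝ → ℝ) (r θ z : ℝ) : ℝ :=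
  -z * Real.cos θ * p1 f r θ z + (z * Real.sin θ / r) * p2 f r θ z
    + r * Real.cos θ * p3 f r θ z

/-- `X₇ f = z sin θ · f_r + (z cos θ / r) · f_θ − r sin θ · f_z`. -/
noncomputable def X7 (f : ℝ → ℝ → ℝ → ℝ) (r θ z : ℝ) : ℝ :=
  z * Real.sin θ * p1 f r θ z + (z * Real.cos θ / r) * p2 f r θ z
    - r * Real.sin θ * p3 f r θ z

lemma aux_two' : (2 : WithTop ℕ∞) ≤ ((⊤ : ℕ∞) : WithTop ℕ∞) :=
  WithTop.coe_le_coe.2 (le_top : (2 : ℕ∞) ≤ ⊤)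

lemma aux_two : (1 : WithTop ℕ∞) + 1 ≤ ((⊤ : ℕ∞) : WithTop ℕ∞) := by
  rw [one_add_one_eq_two]; exact aux_two'

lemma aux_deriv (F : ℝ × ℝ × ℝ → ℝ) (hF : Differentiable ℝ F) (r θ z : ℝ) :
    HasDerivAt (fun s => F (s, θ, z)) (fderiv ℝ F (r, θ, z) (1, 0, 0)) r ∧
    HasDerivAt (fun s => F (r, s, z)) (fderiv ℝ F (r, θ, z) (0, 1, 0)) θ ∧
    HasDerivAt (fun s => F (r, θ, s)) (fderiv ℝ F (r, θ, z) (0, 0, 1)) z := by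
  have h := (hF (r, θ, z)).hasFDerivAt
  refine ⟨?_, ?_, ?_⟩
  · exact h.comp_hasDerivAt r ((hasDerivAt_id r).prodMk
      ((hasDerivAt_const r θ).prodMk (hasDerivAt_const r z)))
  · exact h.comp_hasDerivAt θ ((hasDerivAt_const θ r).prodMk
      ((hasDerivAt_id θ).prodMk (hasDerivAt_const θ z)))
  · exact h.comp_hasDerivAt z ((hasDerivAt_const z r).prodMk
      ((hasDerivAt_const z θ).prodMk (hasDerivAt_id z)))

lemma aux_symm (F : ℝ × ℝ × ℝ → ℝ) (hF : ContDiff ℝ (⊤ : ℕ∞) F) (v w x : ℝ × ℝ × ℝ) :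
    fderiv ℝ (fun p => fderiv ℝ F p v) x w = fderiv ℝ (fun p => fderiv ℝ F p w) x v := by
  have hd : Differentiable ℝ (fderiv ℝ F) :=
    (hF.fderiv_right (m := 1) aux_two).differentiable (by norm_num)
  have key : ∀ v w, fderiv ℝ (fun p => fderiv ℝ F p v) x w = fderiv ℝ (fderiv ℝ F) x w v := by
    intro v w
    rw [fderiv_clm_apply (hd x) (differentiableAt_const v)]
    simp
  rw [key, key]
  have hs : IsSymmSndFDerivAt ℝ F x :=
    hF.contDiffAt.isSymmSndFDerivAt (by
      simp only [minSmoothness_of_isRCLikeNormedField]; exact aux_two')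
  exact hs w v

/-- Commutator table entries: `[X₁, X₆] = X₇` and `[X₁, X₇] = −X₆`. -/
theorem commutator_X1_X6_X7 (f : ℝ → ℝ → ℝ → ℝ)
    (hf : ContDiff ℝ (⊤ : ℕ∞) (fun p : ℝ × ℝ × ℝ => f p.1 p.2.1 p.2.2)) :
    ∀ r θ z : ℝ, 0 < r →
      X1 (X6 f) r θ z - X6 (X1 f) r θ z = X7 f r θ z ∧
      X1 (X7 f) r θ z - X7 (X1 f) r θ z = -(X6 f r θ z) := by
  intro r θ z _
  obtain ⟨F, hFdef⟩ : ∃ F : ℝ × ℝ × ℝ → ℝ, F = fun p => f p.1 p.2.1 p.2.2 := ⟨_, rfl⟩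
  rw [← hFdef] at hf
  have hfF : f = fun a b c => F (a, b, c) := by rw [hFdef]
  clear hFdef
  have hd : Differentiable ℝ F := hf.differentiable (by simp)
  have e1 : p1 f = fun a b c => fderiv ℝ F (a, b, c) (1, 0, 0) := by
    funext a b c; rw [hfF]; exact (aux_deriv F hd a b c).1.deriv
  have e2 : p2 f = fun a b c => fderiv ℝ F (a, b, c) (0, 1, 0) := by
    funext a b c; rw [hfF]; exact (aux_deriv F hd a b c).2.1.deriv
  have e3 : p3 f = fun a b c => fderiv ℝ F (a, b, c) (0, 0, 1) := by
    funext a b c; rw [hfF]; exact (aux_deriv F hd a b c).2.2.deriv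
  have hdd : ∀ v, Differentiable ℝ (fun p => fderiv ℝ F p v) := fun v =>
    ((hf.fderiv_right (m := 1) aux_two).differentiable (by norm_num)).clm_apply
      (differentiable_const v)
  have d1 := (aux_deriv _ (hdd (1, 0, 0)) r θ z).2.1
  have d2 := (aux_deriv _ (hdd (0, 1, 0)) r θ z).2.1
  have d3 := (aux_deriv _ (hdd (0, 0, 1)) r θ z).2.1
  have g := aux_deriv _ (hdd (0, 1, 0)) r θ z
  rw [aux_symm F hf] at d1 d3
  have x1 : X1 f = p2 f := rfl
  have q1 : p1 (p2 f) r θ z =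
      fderiv ℝ (fun p => fderiv ℝ F p (0, 1, 0)) (r, θ, z) (1, 0, 0) := by
    rw [e2]; exact g.1.deriv
  have q2 : p2 (p2 f) r θ z =
      fderiv ℝ (fun p => fderiv ℝ F p (0, 1, 0)) (r, θ, z) (0, 1, 0) := by
    rw [e2]; exact g.2.1.deriv
  have q3 : p3 (p2 f) r θ z =
      fderiv ℝ (fun p => fderiv ℝ F p (0, 1, 0)) (r, θ, z) (0, 0, 1) := by
    rw [e2]; exact g.2.2.deriv
  rw [← q1] at d1
  rw [← q2] at d2
  rw [← q3] at d3
  have hs := Real.hasDerivAt_sin θ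
  have hc := Real.hasDerivAt_cos θ
  have c1 : HasDerivAt (fun s => p1 f r s z) (p1 (p2 f) r θ z) θ := by rw [e1]; exact d1
  have c2 : HasDerivAt (fun s => p2 f r s z) (p2 (p2 f) r θ z) θ := by
    convert d2 using 1; rw [e2]
  have c3 : HasDerivAt (fun s => p3 f r s z) (p3 (p2 f) r θ z) θ := by rw [e3]; exact d3
  have h6 : ∀ A, HasDerivAt (fun s => X6 f r s z) A θ → X1 (X6 f) r θ z = A :=
    fun A h => h.deriv
  have h7 : ∀ A, HasDerivAt (fun s => X7 f r s z) A θ → X1 (X7 f) r θ z = A :=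
    fun A h => h.deriv
  have a6 := h6 _ ((((hc.const_mul (-z)).mul c1).add (((hs.const_mul z).div_const r).mul c2)).add
      ((hc.const_mul r).mul c3))
  have a7 := h7 _ ((((hs.const_mul z).mul c1).add (((hc.const_mul z).div_const r).mul c2)).sub
      ((hs.const_mul r).mul c3))
  rw [a6, a7, x1]
  simp only [X6, X7]
  constructor <;> ring
end

section
/- For every smooth function f : ℝ³ → ℝ and every point (r,θ,z) with r > 0, the commutator identities [X₄,X₇]f = −X₂f, [X₅,X₆]f = −X₂f, and [X₆,X₇]f = X₁f hold at (r,θ,z). (Entries of the commutator Table 1 of Theorem 1.) -/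
/-- Smoothness of the uncurried function. -/
def Sm (f : ℝ → ℝ → ℝ → ℝ) : Prop :=
  ContDiff ℝ (⊤ : ℕ∞) (fun p : ℝ × ℝ × ℝ => f p.1 p.2.1 p.2.2)

lemma Sm.h1 {f : ℝ → ℝ → ℝ → ℝ} (hf : Sm f) (r θ z : ℝ) :
    HasDerivAt (fun s => f s θ z)
      (fderiv ℝ (fun p : ℝ × ℝ × ℝ => f p.1 p.2.1 p.2.2) (r, θ, z) (1, 0, 0)) r := by
  have h := (hf.differentiable (by simp) (r, θ, z)).hasFDerivAt
  exact HasFDerivAt.comp_hasDerivAt (f := fun s : ℝ => ((s, θ, z) : ℝ × ℝ × ℝ)) r h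
    ((hasDerivAt_id r).prodMk ((hasDerivAt_const r θ).prodMk (hasDerivAt_const r z)))

lemma Sm.h2 {f : ℝ → ℝ → ℝ → ℝ} (hf : Sm f) (r θ z : ℝ) :
    HasDerivAt (fun s => f r s z)
      (fderiv ℝ (fun p : ℝ × ℝ × ℝ => f p.1 p.2.1 p.2.2) (r, θ, z) (0, 1, 0)) θ := by
  have h := (hf.differentiable (by simp) (r, θ, z)).hasFDerivAt
  exact HasFDerivAt.comp_hasDerivAt (f := fun s : ℝ => ((r, s, z) : ℝ × ℝ × ℝ)) θ h
    ((hasDerivAt_const θ r).prodMk ((hasDerivAt_id θ).prodMk (hasDerivAt_const θ z)))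

lemma Sm.h3 {f : ℝ → ℝ → ℝ → ℝ} (hf : Sm f) (r θ z : ℝ) :
    HasDerivAt (fun s => f r θ s)
      (fderiv ℝ (fun p : ℝ × ℝ × ℝ => f p.1 p.2.1 p.2.2) (r, θ, z) (0, 0, 1)) z := by
  have h := (hf.differentiable (by simp) (r, θ, z)).hasFDerivAt
  exact HasFDerivAt.comp_hasDerivAt (f := fun s : ℝ => ((r, θ, s) : ℝ × ℝ × ℝ)) z h
    ((hasDerivAt_const z r).prodMk ((hasDerivAt_const z θ).prodMk (hasDerivAt_id z)))

lemma Sm.d1 {f : ℝ → ℝ → ℝ → ℝ} (hf : Sm f) (r θ z : ℝ) :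
    HasDerivAt (fun s => f s θ z) (p1 f r θ z) r := (hf.h1 r θ z).differentiableAt.hasDerivAt
lemma Sm.d2 {f : ℝ → ℝ → ℝ → ℝ} (hf : Sm f) (r θ z : ℝ) :
    HasDerivAt (fun s => f r s z) (p2 f r θ z) θ := (hf.h2 r θ z).differentiableAt.hasDerivAt
lemma Sm.d3 {f : ℝ → ℝ → ℝ → ℝ} (hf : Sm f) (r θ z : ℝ) :
    HasDerivAt (fun s => f r θ s) (p3 f r θ z) z := (hf.h3 r θ z).differentiableAt.hasDerivAt

lemma Sm.e1 {f : ℝ → ℝ → ℝ → ℝ} (hf : Sm f) :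
    (fun p : ℝ × ℝ × ℝ => p1 f p.1 p.2.1 p.2.2) =
    fun p => fderiv ℝ (fun p : ℝ × ℝ × ℝ => f p.1 p.2.1 p.2.2) p (1, 0, 0) := by
  funext p; exact (hf.h1 _ _ _).deriv
lemma Sm.e2 {f : ℝ → ℝ → ℝ → ℝ} (hf : Sm f) :
    (fun p : ℝ × ℝ × ℝ => p2 f p.1 p.2.1 p.2.2) =
    fun p => fderiv ℝ (fun p : ℝ × ℝ × ℝ => f p.1 p.2.1 p.2.2) p (0, 1, 0) := by
  funext p; exact (hf.h2 _ _ _).deriv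
lemma Sm.e3 {f : ℝ → ℝ → ℝ → ℝ} (hf : Sm f) :
    (fun p : ℝ × ℝ × ℝ => p3 f p.1 p.2.1 p.2.2) =
    fun p => fderiv ℝ (fun p : ℝ × ℝ × ℝ => f p.1 p.2.1 p.2.2) p (0, 0, 1) := by
  funext p; exact (hf.h3 _ _ _).deriv

lemma Sm.fd {f : ℝ → ℝ → ℝ → ℝ} (hf : Sm f) :
    ContDiff ℝ (⊤ : ℕ∞) (fderiv ℝ (fun p : ℝ × ℝ × ℝ => f p.1 p.2.1 p.2.2)) :=
  ContDiff.fderiv_right hf (by simp)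

lemma Sm.s1 {f : ℝ → ℝ → ℝ → ℝ} (hf : Sm f) : Sm (p1 f) := by
  unfold Sm; rw [hf.e1]; exact hf.fd.clm_apply contDiff_const
lemma Sm.s2 {f : ℝ → ℝ → ℝ → ℝ} (hf : Sm f) : Sm (p2 f) := by
  unfold Sm; rw [hf.e2]; exact hf.fd.clm_apply contDiff_const
lemma Sm.s3 {f : ℝ → ℝ → ℝ → ℝ} (hf : Sm f) : Sm (p3 f) := by
  unfold Sm; rw [hf.e3]; exact hf.fd.clm_apply contDiff_const

lemma Sm.sym {f : ℝ → ℝ → ℝ → ℝ} (hf : Sm f) (p v w : ℝ × ℝ × ℝ) :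
    fderiv ℝ (fun q => fderiv ℝ (fun p : ℝ × ℝ × ℝ => f p.1 p.2.1 p.2.2) q v) p w =
    fderiv ℝ (fun q => fderiv ℝ (fun p : ℝ × ℝ × ℝ => f p.1 p.2.1 p.2.2) q w) p v := by
  have hd := hf.fd.differentiable (by simp) p
  have key := (ContDiff.contDiffAt (x := p) hf).isSymmSndFDerivAt (by simp only [minSmoothness_of_isRCLikeNormedField]; exact WithTop.coe_le_coe.2 (le_top : (2 : ℕ∞) ≤ ⊤))
  rw [fderiv_clm_apply hd (by fun_prop), fderiv_clm_apply hd (by fun_prop)]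
  simpa using key w v

lemma Sm.c12 {f : ℝ → ℝ → ℝ → ℝ} (hf : Sm f) (r θ z : ℝ) :
    p2 (p1 f) r θ z = p1 (p2 f) r θ z := by
  have a := (hf.s1.h2 r θ z).deriv
  have b := (hf.s2.h1 r θ z).deriv
  rw [hf.e1] at a
  rw [hf.e2] at b
  exact a.trans ((hf.sym _ _ _).trans b.symm)
lemma Sm.c13 {f : ℝ → ℝ → ℝ → ℝ} (hf : Sm f) (r θ z : ℝ) :
    p3 (p1 f) r θ z = p1 (p3 f) r θ z := by
  have a := (hf.s1.h3 r θ z).deriv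
  have b := (hf.s3.h1 r θ z).deriv
  rw [hf.e1] at a
  rw [hf.e3] at b
  exact a.trans ((hf.sym _ _ _).trans b.symm)
lemma Sm.c23 {f : ℝ → ℝ → ℝ → ℝ} (hf : Sm f) (r θ z : ℝ) :
    p3 (p2 f) r θ z = p2 (p3 f) r θ z := by
  have a := (hf.s2.h3 r θ z).deriv
  have b := (hf.s3.h2 r θ z).deriv
  rw [hf.e2] at a
  rw [hf.e3] at b
  exact a.trans ((hf.sym _ _ _).trans b.symm)

/-- The field with general coefficients. -/
noncomputable def G (a b c f : ℝ → ℝ → ℝ → ℝ) (r θ z : ℝ) : ℝ :=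
  a r θ z * p1 f r θ z + b r θ z * p2 f r θ z + c r θ z * p3 f r θ z

lemma G1 {a b c f : ℝ → ℝ → ℝ → ℝ} (hf : Sm f) {r θ z a' b' c' : ℝ}
    (ha : HasDerivAt (fun s => a s θ z) a' r) (hb : HasDerivAt (fun s => b s θ z) b' r)
    (hc : HasDerivAt (fun s => c s θ z) c' r) :
    p1 (G a b c f) r θ z = (a' * p1 f r θ z + a r θ z * p1 (p1 f) r θ z)
      + (b' * p2 f r θ z + b r θ z * p1 (p2 f) r θ z)
      + (c' * p3 f r θ z + c r θ z * p1 (p3 f) r θ z) :=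
  (((ha.mul (hf.s1.d1 r θ z)).add (hb.mul (hf.s2.d1 r θ z))).add (hc.mul (hf.s3.d1 r θ z))).deriv

lemma G2 {a b c f : ℝ → ℝ → ℝ → ℝ} (hf : Sm f) {r θ z a' b' c' : ℝ}
    (ha : HasDerivAt (fun s => a r s z) a' θ) (hb : HasDerivAt (fun s => b r s z) b' θ)
    (hc : HasDerivAt (fun s => c r s z) c' θ) :
    p2 (G a b c f) r θ z = (a' * p1 f r θ z + a r θ z * p1 (p2 f) r θ z)
      + (b' * p2 f r θ z + b r θ z * p2 (p2 f) r θ z)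
      + (c' * p3 f r θ z + c r θ z * p2 (p3 f) r θ z) := by
  rw [← hf.c12]
  exact (((ha.mul (hf.s1.d2 r θ z)).add (hb.mul (hf.s2.d2 r θ z))).add
    (hc.mul (hf.s3.d2 r θ z))).deriv

lemma G3 {a b c f : ℝ → ℝ → ℝ → ℝ} (hf : Sm f) {r θ z a' b' c' : ℝ}
    (ha : HasDerivAt (fun s => a r θ s) a' z) (hb : HasDerivAt (fun s => b r θ s) b' z)
    (hc : HasDerivAt (fun s => c r θ s) c' z) :
    p3 (G a b c f) r θ z = (a' * p1 f r θ z + a r θ z * p1 (p3 f) r θ z)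
      + (b' * p2 f r θ z + b r θ z * p2 (p3 f) r θ z)
      + (c' * p3 f r θ z + c r θ z * p3 (p3 f) r θ z) := by
  rw [← hf.c13, ← hf.c23]
  exact (((ha.mul (hf.s1.d3 r θ z)).add (hb.mul (hf.s2.d3 r θ z))).add
    (hc.mul (hf.s3.d3 r θ z))).deriv

/-- The common shape: `a = k z · u`, `b = k z · v / r`, `c = r · w`, with `u, v, w` trigonometric. -/
noncomputable def T (k u v w : ℝ → ℝ) (f : ℝ → ℝ → ℝ → ℝ) : ℝ → ℝ → ℝ → ℝ :=
  G (fun _ θ z => k z * u θ) (fun r θ z => k z * v θ * r⁻¹) (fun r θ _ => r * w θ) f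

lemma T1 {k u v w : ℝ → ℝ} {f : ℝ → ℝ → ℝ → ℝ} (hf : Sm f) {r θ z : ℝ} (hr : r ≠ 0) :
    p1 (T k u v w f) r θ z = (0 * p1 f r θ z + k z * u θ * p1 (p1 f) r θ z)
      + ((k z * v θ * (-(r ^ 2)⁻¹)) * p2 f r θ z + k z * v θ * r⁻¹ * p1 (p2 f) r θ z)
      + (1 * w θ * p3 f r θ z + r * w θ * p1 (p3 f) r θ z) :=
  G1 hf (hasDerivAt_const _ _) ((hasDerivAt_inv hr).const_mul _) ((hasDerivAt_id r).mul_const _)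

lemma T2 {k u v w : ℝ → ℝ} {f : ℝ → ℝ → ℝ → ℝ} (hf : Sm f) {r θ z u' v' w' : ℝ}
    (hu : HasDerivAt u u' θ) (hv : HasDerivAt v v' θ) (hw : HasDerivAt w w' θ) :
    p2 (T k u v w f) r θ z = (k z * u' * p1 f r θ z + k z * u θ * p1 (p2 f) r θ z)
      + (k z * v' * r⁻¹ * p2 f r θ z + k z * v θ * r⁻¹ * p2 (p2 f) r θ z)
      + (r * w' * p3 f r θ z + r * w θ * p2 (p3 f) r θ z) :=
  G2 hf (hu.const_mul _) ((hv.const_mul _).mul_const _) (hw.const_mul _)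

lemma T3 {k u v w : ℝ → ℝ} {f : ℝ → ℝ → ℝ → ℝ} (hf : Sm f) {r θ z k' : ℝ}
    (hk : HasDerivAt k k' z) :
    p3 (T k u v w f) r θ z = (k' * u θ * p1 f r θ z + k z * u θ * p1 (p3 f) r θ z)
      + (k' * v θ * r⁻¹ * p2 f r θ z + k z * v θ * r⁻¹ * p2 (p3 f) r θ z)
      + (0 * p3 f r θ z + r * w θ * p3 (p3 f) r θ z) :=
  G3 hf (hk.mul_const _) ((hk.mul_const _).mul_const _) (hasDerivAt_const _ _)

lemma X4T (f : ℝ → ℝ → ℝ → ℝ) : X4 f = T (fun _ => 1) Real.sin Real.cos (fun _ => 0) f := by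
  funext r θ z; simp only [X4, T, G]; ring
lemma X5T (f : ℝ → ℝ → ℝ → ℝ) :
    X5 f = T (fun _ => 1) (fun t => -Real.cos t) Real.sin (fun _ => 0) f := by
  funext r θ z; simp only [X5, T, G]; ring
lemma X6T (f : ℝ → ℝ → ℝ → ℝ) :
    X6 f = T (fun z => z) (fun t => -Real.cos t) Real.sin Real.cos f := by
  funext r θ z; simp only [X6, T, G]; ring
lemma X7T (f : ℝ → ℝ → ℝ → ℝ) :
    X7 f = T (fun z => z) Real.sin Real.cos (fun t => -Real.sin t) f := by
  funext r θ z; simp only [X7, T, G]; ring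

/-- Commutator table entries: `[X₄, X₇] = −X₂`, `[X₅, X₆] = −X₂`, `[X₆, X₇] = X₁`. -/
theorem commutator_X4X7_X5X6_X6X7 (f : ℝ → ℝ → ℝ → ℝ)
    (hf : ContDiff ℝ (⊤ : ℕ∞) (fun p : ℝ × ℝ × ℝ => f p.1 p.2.1 p.2.2)) :
    ∀ r θ z : ℝ, 0 < r →
      X4 (X7 f) r θ z - X7 (X4 f) r θ z = -(X2 f r θ z) ∧
      X5 (X6 f) r θ z - X6 (X5 f) r θ z = -(X2 f r θ z) ∧
      X6 (X7 f) r θ z - X7 (X6 f) r θ z = X1 f r θ z := by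
  intro r θ z hr
  have hS : Sm f := hf
  have hr' : r ≠ 0 := hr.ne'
  have s := Real.hasDerivAt_sin θ
  have c := Real.hasDerivAt_cos θ
  have o := hasDerivAt_const θ (0 : ℝ)
  have i := hasDerivAt_const z (1 : ℝ)
  have j := hasDerivAt_id' z
  have hsc : Real.cos θ ^ 2 = 1 - Real.sin θ ^ 2 := by
    linarith [Real.sin_sq_add_cos_sq θ]
  refine ⟨?_, ?_, ?_⟩
  · rw [X4, X7, X2, X4T, X7T, T1 hS hr', T2 hS s c s.fun_neg, T1 hS hr', T2 hS s c o, T3 hS i]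
    field_simp
    ring_nf
    simp only [hsc]
    ring
  · rw [X5, X6, X2, X5T, X6T, T1 hS hr', T2 hS c.fun_neg s c, T1 hS hr', T2 hS c.fun_neg s o,
      T3 hS i]
    field_simp
    ring_nf
    simp only [hsc]
    ring
  · rw [X6, X7, X1, X6T, X7T, T1 hS hr', T2 hS s c s.fun_neg, T3 hS j, T1 hS hr',
      T2 hS c.fun_neg s c, T3 hS j]
    field_simp
    ring_nf
    simp only [hsc]
    ring
end
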